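/- Under the Lemma 6 setup (see context), the set A₀ ∖ {x+1} contains no element a such that a − 1 ∈ X. -/

import Mathlib

open Finset

/-- `s^{n,k} = (n(n+1)/2)/k`. -/
def magicConst (n k : ℕ) : ℕ := (n * (n + 1) / 2) / k

/-- `A` is a partition of `[n] = {1,…,n}` into `k` (indexed) parts. -/
def IsPartitionOn (n : ℕ) {k : ℕ} (A : Fin k → Finset ℕ) : Prop :=
  (∀ i j : Fin k, i ≠ j → Disjoint (A i) (A j)) ∧
    Finset.univ.biUnion A = Finset.Icc 1 n

/-- The partition `A` of `[n]` implements the sequence of sizes `p` (up to reindexing). -/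
def Implements (n : ℕ) {k : ℕ} (A : Fin k → Finset ℕ) (p : Fin k → ℕ) : Prop :=
  IsPartitionOn n A ∧ ∃ e : Equiv.Perm (Fin k), ∀ i, (A (e i)).card = p i

/-- Every part of the partition has sum `s^{n,k}`. -/
def Equitable (n : ℕ) {k : ℕ} (A : Fin k → Finset ℕ) : Prop :=
  ∀ i, (A i).sum id = magicConst n k

/-- `d(A) = Σ_i (S(A_i) − s^{n,k})²`. -/
def dVal (n : ℕ) {k : ℕ} (A : Fin k → Finset ℕ) : ℤ :=
  ∑ i : Fin k, ((((A i).sum id : ℕ) : ℤ) - (magicConst n k : ℤ)) ^ 2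

/-- A partition implementing `p` minimizing `d` among all partitions implementing `p`. -/
def MinimalPartition (n : ℕ) {k : ℕ} (A : Fin k → Finset ℕ) (p : Fin k → ℕ) : Prop :=
  Implements n A p ∧ ∀ B : Fin k → Finset ℕ, Implements n B p → dVal n A ≤ dVal n B

/-- Condition (★): `Σ_{i=1}^{P_j} (n−i+1) ≥ j·s^{n,k}` for all `j = 1,…,k`,
where `P_j = p_1 + ⋯ + p_j`. -/
def StarCond (n k : ℕ) (p : Fin k → ℕ) : Prop :=
  ∀ j : Fin k,
    ((j : ℕ) + 1) * magicConst n k ≤ ∑ i ∈ Finset.range (∑ t ∈ Finset.Iic j, p t), (n - i)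

/-- The width `ω(A)` of a partition: the minimum of `y − x` over pairs `x < y` with `x`
in a low set and `y` in a high set (`⊤` if there is no such pair). -/
noncomputable def width (n : ℕ) {k : ℕ} (A : Fin k → Finset ℕ) : ℕ∞ :=
  sInf { w : ℕ∞ | ∃ (x y : ℕ) (i j : Fin k), x ∈ A i ∧ y ∈ A j ∧ x < y ∧
    (A i).sum id < magicConst n k ∧ magicConst n k < (A j).sum id ∧ w = (y - x : ℕ) }

/-- The family obtained from `A` by exchanging the elements `b` and `b + 1`. -/
def swapSucc (b : ℕ) {k : ℕ} (A : Fin k → Finset ℕ) : Fin k → Finset ℕ :=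
  fun i => (A i).map (Equiv.swap b (b + 1)).toEmbedding

theorem mem_map_swap_succ {S : Finset ℕ} {b c : ℕ} (hb : c ≠ b) (hb' : c ≠ b + 1) (hc : c ∈ S) :
    c ∈ S.map (Equiv.swap b (b + 1)).toEmbedding :=
  Finset.mem_map.2 ⟨c, hc, Equiv.swap_apply_of_ne_of_ne hb hb'⟩

theorem sum_map_swap_succ_of_notMem {S : Finset ℕ} {b : ℕ} (hb : b ∉ S) (hb' : b + 1 ∉ S) :
    (S.map (Equiv.swap b (b + 1)).toEmbedding).sum id = S.sum id := by
  rw [Finset.sum_map]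
  refine Finset.sum_congr rfl fun c hc => ?_
  exact Equiv.swap_apply_of_ne_of_ne (fun h => hb (h ▸ hc)) (fun h => hb' (h ▸ hc))

theorem sum_map_swap_succ {S : Finset ℕ} {b : ℕ} (hb : b ∈ S) (hb' : b + 1 ∉ S) :
    (S.map (Equiv.swap b (b + 1)).toEmbedding).sum id = S.sum id + 1 := by
  have h := sum_map_swap_succ_of_notMem (Finset.notMem_erase b S)
    (fun h => hb' (Finset.mem_of_mem_erase h))
  rw [Finset.sum_map] at h ⊢
  rw [← Finset.add_sum_erase _ _ hb, h, ← Finset.add_sum_erase S id hb]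
  simp
  omega

theorem sum_map_swap_succ_add_one {S : Finset ℕ} {b : ℕ} (hb : b ∉ S) (hb' : b + 1 ∈ S) :
    (S.map (Equiv.swap b (b + 1)).toEmbedding).sum id + 1 = S.sum id := by
  have h := sum_map_swap_succ_of_notMem (fun h => hb (Finset.mem_of_mem_erase h))
    (Finset.notMem_erase (b + 1) S)
  rw [Finset.sum_map] at h ⊢
  rw [← Finset.add_sum_erase _ _ hb', h, ← Finset.add_sum_erase S id hb']
  simp
  omega

theorem IsPartitionOn.mem_Icc {n k : ℕ} {A : Fin k → Finset ℕ} (hA : IsPartitionOn n A)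
    {i : Fin k} {a : ℕ} (ha : a ∈ A i) : a ∈ Finset.Icc 1 n :=
  hA.2 ▸ Finset.mem_biUnion.2 ⟨i, Finset.mem_univ i, ha⟩

theorem IsPartitionOn.swapSucc {n k b : ℕ} {A : Fin k → Finset ℕ} (hA : IsPartitionOn n A)
    (hb : b ∈ Finset.Icc 1 n) (hb' : b + 1 ∈ Finset.Icc 1 n) :
    IsPartitionOn n (swapSucc b A) := by
  refine ⟨fun i j hij => (Finset.disjoint_map _).2 (hA.1 i j hij), ?_⟩
  have hmap : Finset.univ.biUnion (_root_.swapSucc b A) =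
      (Finset.Icc 1 n).map (Equiv.swap b (b + 1)).toEmbedding := by
    rw [← hA.2]
    ext c
    simp only [_root_.swapSucc, Finset.mem_biUnion, Finset.mem_map]
    grind
  rw [hmap]
  refine Finset.eq_of_subset_of_card_le (fun c hc => ?_) (Finset.card_map _).ge
  obtain ⟨a, ha, rfl⟩ := Finset.mem_map.1 hc
  rw [Equiv.coe_toEmbedding, Equiv.swap_apply_def]
  split_ifs <;> assumption

theorem Implements.swapSucc {n k b : ℕ} {A : Fin k → Finset ℕ} {p : Fin k → ℕ}
    (hA : Implements n A p) (hb : b ∈ Finset.Icc 1 n) (hb' : b + 1 ∈ Finset.Icc 1 n) :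
    Implements n (swapSucc b A) p := by
  obtain ⟨hP, e, he⟩ := hA
  exact ⟨hP.swapSucc hb hb', e, fun i => (Finset.card_map _).trans (he i)⟩

theorem width_le {n k : ℕ} {A : Fin k → Finset ℕ} {i j : Fin k} {x y : ℕ} (hx : x ∈ A i)
    (hy : y ∈ A j) (hxy : x < y) (hi : (A i).sum id < magicConst n k)
    (hj : magicConst n k < (A j).sum id) : width n A ≤ (y - x : ℕ) :=
  sInf_le ⟨x, y, i, j, hx, hy, hxy, hi, hj, rfl⟩

/-- Lemma 6(ii). -/
theorem stmt_14 (n : ℕ) (hn : 0 < n) (hdvd : 4 ∣ n * (n + 1) / 2)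
    (p : Fin 4 → ℕ) (hp : ∀ i, 0 < p i)
    (X Y Z W : Finset ℕ)
    (hmin : MinimalPartition n ![X, Y, Z, W] p)
    (hminw : ∀ B : Fin 4 → Finset ℕ, MinimalPartition n B p →
      width n ![X, Y, Z, W] ≤ width n B)
    (hfin : width n ![X, Y, Z, W] ≠ ⊤)
    (hX : X.sum id + 1 = magicConst n 4)
    (hY : Y.sum id = magicConst n 4 + 1)
    (hZ : Z.sum id = magicConst n 4) (hW : W.sum id = magicConst n 4)
    (x y : ℕ) (hx : x ∈ X) (hy : y ∈ Y) (hxy : x < y)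
    (hw : width n ![X, Y, Z, W] = ((y - x : ℕ) : ℕ∞))
    (A₀ B₀ : Finset ℕ) (hA₀ : A₀ = Z ∨ A₀ = W) (hB₀ : B₀ = Z ∨ B₀ = W)
    (hxA : x + 1 ∈ A₀) (hyB : y - 1 ∈ B₀) :
    ∀ b : ℕ, b ∈ X → b + 1 ∈ A₀ → b + 1 = x + 1 := by
  intro b hb hbA
  by_contra hne
  obtain ⟨j, hj0, hj1, hjA, hjs⟩ : ∃ j : Fin 4, j ≠ 0 ∧ j ≠ 1 ∧ ![X, Y, Z, W] j = A₀ ∧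
      (![X, Y, Z, W] j).sum id = magicConst n 4 := by
    rcases hA₀ with rfl | rfl
    · exact ⟨2, by decide, by decide, rfl, hZ⟩
    · exact ⟨3, by decide, by decide, rfl, hW⟩
  rw [← hjA] at hxA hbA
  have hP : IsPartitionOn n ![X, Y, Z, W] := hmin.1.1
  have hbj : b ∉ ![X, Y, Z, W] j := Finset.disjoint_left.1 (hP.1 0 j hj0.symm) hb
  have hb0 : b + 1 ∉ X := Finset.disjoint_left.1 (hP.1 j 0 hj0) hbA
  have hother : ∀ i, i ≠ 0 → i ≠ j →
      (swapSucc b ![X, Y, Z, W] i).sum id = (![X, Y, Z, W] i).sum id := fun i hi hij =>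
    sum_map_swap_succ_of_notMem (Finset.disjoint_left.1 (hP.1 0 i hi.symm) hb)
      (Finset.disjoint_left.1 (hP.1 j i hij.symm) hbA)
  have hs0 : (swapSucc b ![X, Y, Z, W] 0).sum id = X.sum id + 1 := sum_map_swap_succ hb hb0
  have hsj : (swapSucc b ![X, Y, Z, W] j).sum id + 1 = (![X, Y, Z, W] j).sum id :=
    sum_map_swap_succ_add_one hbj hbA
  have hs1 : (swapSucc b ![X, Y, Z, W] 1).sum id = Y.sum id := hother 1 (by decide) hj1.symm
  have himp : Implements n (swapSucc b ![X, Y, Z, W]) p :=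
    hmin.1.swapSucc (hP.mem_Icc (i := 0) hb) (hP.mem_Icc hbA)
  have hd : dVal n (swapSucc b ![X, Y, Z, W]) = dVal n ![X, Y, Z, W] := by
    have hval : ∀ B : Fin 4 → Finset ℕ, ∀ k l : Fin 4, k ≠ l →
        (B k).sum id + 1 = magicConst n 4 → (B l).sum id = magicConst n 4 + 1 →
        (∀ i, i ≠ k → i ≠ l → (B i).sum id = magicConst n 4) → dVal n B = 2 := by
      intro B k l hkl hk hl hi
      rw [dVal, ← Finset.sum_subset (Finset.subset_univ {k, l}), Finset.sum_pair hkl, hl, ← hk]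
      · push_cast
        ring
      · intro i _ h
        simp only [Finset.mem_insert, Finset.mem_singleton, not_or] at h
        rw [hi i h.1 h.2, sub_self, sq, mul_zero]
    have hbal : ∀ i, i ≠ 0 → i ≠ 1 → (![X, Y, Z, W] i).sum id = magicConst n 4 := by
      intro i h0 h1
      fin_cases i
      exacts [absurd rfl h0, absurd rfl h1, hZ, hW]
    rw [hval _ 0 1 (by decide) hX hY hbal,
      hval _ j 1 hj1 (hsj.trans hjs) (hs1.trans hY) fun i hij h1 => ?_]
    by_cases h0 : i = 0
    · rw [h0, hs0, hX]
    · rw [hother i h0 hij, hbal i h0 h1]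
  have hBmin : MinimalPartition n (swapSucc b ![X, Y, Z, W]) p :=
    ⟨himp, fun C hC => hd ▸ hmin.2 C hC⟩
  have hle := hminw _ hBmin
  have hxy' : x + 1 < y := by
    refine lt_of_le_of_ne hxy fun h => ?_
    exact Finset.disjoint_left.1 (hP.1 j 1 hj1) hxA (h ▸ hy)
  have hxj : x + 1 ∈ swapSucc b ![X, Y, Z, W] j :=
    mem_map_swap_succ (fun h => hbj (h ▸ hxA)) (fun h => hne h.symm) hxA
  have hy1 : y ∈ swapSucc b ![X, Y, Z, W] 1 :=
    mem_map_swap_succ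
      (fun h => Finset.disjoint_left.1 (hP.1 0 1 (by decide)) hb (h ▸ hy))
      (fun h => Finset.disjoint_left.1 (hP.1 j 1 hj1) hbA (h ▸ hy)) hy
  have hlt := hle.trans (width_le hxj hy1 hxy' (by omega) (by omega))
  rw [hw, Nat.cast_le] at hlt
  omega
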